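/- Let G be a DAG over observed nodes V and latent nodes L, and let M be the MAG of G over V. For any X, Y ∈ V, if there is a bi-directed path p between X and Y in G, then there is a path p' between X and Y in M whose nodes form a subsequence of the observed nodes of p such that (1) every non-endpoint node of p' is a collider on p', and (2) for every directed edge A->B on p', G contains an inducing path between A and B that is into A (its first edge has an arrowhead at A). -/

import Mathlib

open Classical

namespace CG

/-! ### Generic list helpers -/

/-- Consecutive triple on a list. -/
def ListTriple {α : Type} (p : List α) (a b c : α) : Prop :=
  ∃ i : ℕ, p[i]? = some a ∧ p[i+1]? = some b ∧ p[i+2]? = some c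

/-- Consecutive pair (an edge) on a list. -/
def ListEdge {α : Type} (p : List α) (a b : α) : Prop :=
  ∃ i : ℕ, p[i]? = some a ∧ p[i+1]? = some b

/-! ### Mixed graphs (MAGs, PAGs) -/

/-- Edge marks of a mixed graph. -/
inductive Mark : Type
  | tail | arrow | circle
  deriving DecidableEq

/-- A mixed graph over `V`: `mark a b` is the edge mark at `b` on the edge
between `a` and `b` (`none` if there is no edge). -/
structure MixedGraph (V : Type) where
  mark : V → V → Option Mark

namespace MixedGraph

variable {V : Type} (G : MixedGraph V)

def WellFormed : Prop :=
  (∀ a b : V, (G.mark a b).isSome ↔ (G.mark b a).isSome) ∧ ∀ a : V, G.mark a a = none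

def Adj (a b : V) : Prop := (G.mark a b).isSome

/-- Directed edge `a → b`. -/
def DirEdge (a b : V) : Prop := G.mark a b = some Mark.arrow ∧ G.mark b a = some Mark.tail

/-- Bi-directed edge `a ↔ b`. -/
def BiEdge (a b : V) : Prop := G.mark a b = some Mark.arrow ∧ G.mark b a = some Mark.arrow

/-- Edge with circle marks at both ends. -/
def CircleEdge (a b : V) : Prop := G.mark a b = some Mark.circle ∧ G.mark b a = some Mark.circle

def NoCircles : Prop := ∀ a b : V, G.mark a b ≠ some Mark.circle

def StrictAnc : V → V → Prop := Relation.TransGen G.DirEdge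

/-- `a` is an ancestor of `b` (reflexive). -/
def Anc : V → V → Prop := Relation.ReflTransGen G.DirEdge

/-- No directed cycles and no almost-directed cycles. -/
def Ancestral : Prop :=
  (∀ a : V, ¬ G.StrictAnc a a) ∧ ∀ a b : V, G.BiEdge a b → ¬ G.StrictAnc a b

def IsPath (p : List V) : Prop := 2 ≤ p.length ∧ p.Nodup ∧ p.Chain' G.Adj

def IsPathBetween (X Y : V) (p : List V) : Prop :=
  G.IsPath p ∧ p.head? = some X ∧ p.getLast? = some Y

/-- `b` is a collider between `a` and `c` (arrowheads at `b` on both edges). -/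
def Collider (a b c : V) : Prop := G.mark a b = some Mark.arrow ∧ G.mark c b = some Mark.arrow

/-- Every non-endpoint node of `p` is a collider on `p`. -/
def AllColliders (p : List V) : Prop := ∀ a b c : V, ListTriple p a b c → G.Collider a b c

/-- `b` is a definite non-collider between `a` and `c`. -/
def DefNonCollider (a b c : V) : Prop :=
  (G.mark a b = some Mark.tail ∨ G.mark c b = some Mark.tail) ∨
  (G.mark a b = some Mark.circle ∧ G.mark c b = some Mark.circle ∧ ¬ G.Adj a c)

/-- Every non-endpoint node of `p` is a definite collider or definite non-collider. -/
def DefStatusPath (p : List V) : Prop :=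
  ∀ a b c : V, ListTriple p a b c → G.Collider a b c ∨ G.DefNonCollider a b c

/-- The path `p` is into its first node (arrowhead at the first node). -/
def IntoFirst (p : List V) : Prop :=
  ∃ a b : V, p[0]? = some a ∧ p[1]? = some b ∧ G.mark b a = some Mark.arrow

/-- The path `p` is into its last node. -/
def IntoLast (p : List V) : Prop := G.IntoFirst p.reverse

/-- m-connecting path between `X` and `Y` given `Z`. -/
def MConnPath (Z : Set V) (X Y : V) (p : List V) : Prop :=
  G.IsPathBetween X Y p ∧
  ∀ a b c : V, ListTriple p a b c →
    (G.Collider a b c → ∃ z ∈ Z, G.Anc b z) ∧ (¬ G.Collider a b c → b ∉ Z)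

/-- m-separation. -/
def MSep (X Y : V) (Z : Set V) : Prop := ¬ ∃ p : List V, G.MConnPath Z X Y p

/-- Every pair of non-adjacent nodes is m-separated by some set. -/
def Maximal : Prop :=
  ∀ a b : V, a ≠ b → ¬ G.Adj a b → ∃ Z : Set V, a ∉ Z ∧ b ∉ Z ∧ G.MSep a b Z

def IsMAG : Prop := G.WellFormed ∧ G.NoCircles ∧ G.Ancestral ∧ G.Maximal

/-- Markov equivalence: same m-separation relations. -/
def MarkovEq (G₁ G₂ : MixedGraph V) : Prop :=
  ∀ (X Y : V) (Z : Set V), G₁.MSep X Y Z ↔ G₂.MSep X Y Z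

/-- Possibly directed edge step from `a` to `b`: an edge not into `a`. -/
def PossDirStep (a b : V) : Prop := G.Adj a b ∧ G.mark b a ≠ some Mark.arrow

/-- `a` is a possible ancestor of `b`. -/
def PossAnc : V → V → Prop := Relation.ReflTransGen G.PossDirStep

/-- Connected by a circle path (same bucket). -/
def SameBucket : V → V → Prop := Relation.ReflTransGen G.CircleEdge

/-- Bi-directed path in a mixed graph. -/
def BiPath (p : List V) : Prop := 2 ≤ p.length ∧ p.Nodup ∧ p.Chain' G.BiEdge

/-- Induced subgraph over `A` (all nodes kept; edges outside `A` removed). -/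
noncomputable def restrict (A : Set V) : MixedGraph V :=
  ⟨fun a b => if a ∈ A ∧ b ∈ A then G.mark a b else none⟩

end MixedGraph

/-! ### DAGs with latent variables -/

/-- A directed graph over observed nodes `V` and latent nodes `L`. -/
structure LatDAG (V L : Type) where
  edge : V ⊕ L → V ⊕ L → Prop

namespace LatDAG

variable {V L : Type} (D : LatDAG V L)

/-- Acyclic, every latent node is parentless and has exactly two children, both observed. -/
def IsCausalDAG : Prop :=
  (∀ x : V ⊕ L, ¬ Relation.TransGen D.edge x x) ∧
  (∀ (x : V ⊕ L) (l : L), ¬ D.edge x (Sum.inr l)) ∧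
  (∀ l : L, ∃ a b : V, a ≠ b ∧ D.edge (Sum.inr l) (Sum.inl a) ∧ D.edge (Sum.inr l) (Sum.inl b) ∧
    ∀ c : V ⊕ L, D.edge (Sum.inr l) c → c = Sum.inl a ∨ c = Sum.inl b)

def Adj (x y : V ⊕ L) : Prop := D.edge x y ∨ D.edge y x

/-- Ancestor (reflexive). -/
def Anc : V ⊕ L → V ⊕ L → Prop := Relation.ReflTransGen D.edge

def IsPath (p : List (V ⊕ L)) : Prop := 2 ≤ p.length ∧ p.Nodup ∧ p.Chain' D.Adj

def IsPathBetween (x y : V ⊕ L) (p : List (V ⊕ L)) : Prop :=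
  D.IsPath p ∧ p.head? = some x ∧ p.getLast? = some y

/-- The path `p` is into its first node (arrowhead at the first node). -/
def IntoFirst (p : List (V ⊕ L)) : Prop :=
  ∃ a b : V ⊕ L, p[0]? = some a ∧ p[1]? = some b ∧ D.edge b a

def IntoLast (p : List (V ⊕ L)) : Prop := D.IntoFirst p.reverse

/-- Inducing path between observed `X` and `Y` (relative to the latent nodes):
every non-endpoint observed node is a collider on the path and an ancestor of `X` or `Y`. -/
def InducingPath (X Y : V) (p : List (V ⊕ L)) : Prop :=
  D.IsPathBetween (Sum.inl X) (Sum.inl Y) p ∧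
  ∀ a b c : V ⊕ L, ListTriple p a b c → ∀ v : V, b = Sum.inl v →
    (D.edge a b ∧ D.edge c b) ∧ (D.Anc b (Sum.inl X) ∨ D.Anc b (Sum.inl Y))

/-- `a` and `b` are joined by a bi-directed edge, i.e. share a latent parent. -/
def LatentSib (a b : V) : Prop :=
  a ≠ b ∧ ∃ l : L, D.edge (Sum.inr l) (Sum.inl a) ∧ D.edge (Sum.inr l) (Sum.inl b)

/-- Bi-directed path between observed nodes (listing the observed nodes). -/
def BiPath (p : List V) : Prop := 2 ≤ p.length ∧ p.Nodup ∧ p.Chain' D.LatentSib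

/-- Same c-component (reflexive): connected by a bi-directed path. -/
def CConn : V → V → Prop := Relation.ReflTransGen D.LatentSib

/-- Induced subgraph over `A ⊆ V`: keep observed nodes of `A` and the latent nodes
both of whose children are in `A`. -/
def restrict (A : Set V) : LatDAG V L :=
  ⟨fun x y =>
    D.edge x y ∧
    (∀ v : V, x = Sum.inl v → v ∈ A) ∧ (∀ v : V, y = Sum.inl v → v ∈ A) ∧
    (∀ l : L, x = Sum.inr l → ∀ w : V, D.edge (Sum.inr l) (Sum.inl w) → w ∈ A) ∧
    (∀ l : L, y = Sum.inr l → ∀ w : V, D.edge (Sum.inr l) (Sum.inl w) → w ∈ A)⟩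

/-- `F` is a c-forest with root set `R` in `D`. -/
def CForest (F R : Set V) : Prop :=
  R ⊆ F ∧
  (∀ a ∈ F, ∀ b ∈ F, ∀ c ∈ F,
    D.edge (Sum.inl a) (Sum.inl b) → D.edge (Sum.inl a) (Sum.inl c) → b = c) ∧
  R = {a ∈ F | ∀ b ∈ F, ¬ D.edge (Sum.inl a) (Sum.inl b)} ∧
  (∀ a ∈ F, ∀ b ∈ F, Relation.ReflTransGen (fun u w => u ∈ F ∧ w ∈ F ∧ D.LatentSib u w) a b)

end LatDAG

/-- `M` is the MAG of the DAG `D` over the observed nodes. -/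
def IsMAGof {V L : Type} (M : MixedGraph V) (D : LatDAG V L) : Prop :=
  (∀ X Y : V, M.Adj X Y ↔ ∃ p : List (V ⊕ L), D.InducingPath X Y p) ∧
  ∀ X Y : V, M.Adj X Y →
    (M.DirEdge X Y ↔ D.Anc (Sum.inl X) (Sum.inl Y)) ∧
    (M.BiEdge X Y ↔ ¬ D.Anc (Sum.inl X) (Sum.inl Y) ∧ ¬ D.Anc (Sum.inl Y) (Sum.inl X))

/-- The directed edge `A → B` of the MAG `M` is visible: no DAG whose MAG is `M`
has an inducing path between `A` and `B` that is into `A`. -/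
def MagVisible {V : Type} (M : MixedGraph V) (A B : V) : Prop :=
  M.DirEdge A B ∧
  ∀ (L : Type) (D : LatDAG V L), D.IsCausalDAG → IsMAGof M D →
    ¬ ∃ p : List (V ⊕ L), D.InducingPath A B p ∧ D.IntoFirst p

/-- `P` is the PAG of the MAG `M`: same adjacencies, and an arrowhead/tail mark appears
in `P` iff it appears in every Markov equivalent MAG. -/
def IsPAGof {V : Type} (P M : MixedGraph V) : Prop :=
  (∀ a b : V, P.Adj a b ↔ M.Adj a b) ∧
  ∀ a b : V, P.Adj a b →
    ((P.mark a b = some Mark.arrow ↔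
        ∀ M' : MixedGraph V, M'.IsMAG → MixedGraph.MarkovEq M M' →
          M'.mark a b = some Mark.arrow) ∧
     (P.mark a b = some Mark.tail ↔
        ∀ M' : MixedGraph V, M'.IsMAG → MixedGraph.MarkovEq M M' →
          M'.mark a b = some Mark.tail))

/-- The directed edge `A → B` of a PAG `P` is visible: `A → B` in `P` and the edge is
visible in every MAG of the equivalence class represented by `P`. -/
def PagVisible {V : Type} (P : MixedGraph V) (A B : V) : Prop :=
  P.DirEdge A B ∧ ∀ M : MixedGraph V, M.IsMAG → IsPAGof P M → MagVisible M A B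

/-- `X` and `Y` are in the same pc-component of the MAG `M`. -/
def SamePCCompMag {V : Type} (M : MixedGraph V) (X Y : V) : Prop :=
  X = Y ∨ ∃ p : List V, M.IsPathBetween X Y p ∧ M.AllColliders p ∧
    ∀ a b : V, ListEdge p a b → ¬ MagVisible M a b ∧ ¬ MagVisible M b a

/-- `X` and `Y` are in the same pc-component of the PAG `P`. -/
def SamePCCompPag {V : Type} (P : MixedGraph V) (X Y : V) : Prop :=
  X = Y ∨ ∃ p : List V, P.IsPathBetween X Y p ∧ P.AllColliders p ∧
    ∀ a b : V, ListEdge p a b → ¬ PagVisible P a b ∧ ¬ PagVisible P b a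

/-- `D` is a DAG in the Markov equivalence class represented by the PAG `P`. -/
def DagInClass {V L : Type} (P : MixedGraph V) (D : LatDAG V L) : Prop :=
  ∃ M : MixedGraph V, M.IsMAG ∧ IsMAGof M D ∧ IsPAGof P M

/-- `C` is a possible child of `X` in a PAG: they are adjacent, the mark at `X` is not
an arrowhead and the mark at `C` is not a tail. -/
def PossChild {V : Type} (P : MixedGraph V) (X C : V) : Prop :=
  P.Adj X C ∧ P.mark C X ≠ some Mark.arrow ∧ P.mark X C ≠ some Mark.tail

/-- The dc-component of the set `X` in a mixed graph. -/
def DCComp {V : Type} (G : MixedGraph V) (X : Set V) : Set V :=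
  {a | ∃ x ∈ X, Relation.ReflTransGen G.BiEdge x a}

/-- The identification criterion of the theorem: no node `Xi ∈ X` is in the same
pc-component of `P_T` with a possible child `C ∈ T \ X`. -/
def BucketCrit {V : Type} (P : MixedGraph V) (T X : Set V) : Prop :=
  ¬ ∃ Xi ∈ X, ∃ C, C ∈ T ∧ C ∉ X ∧
    PossChild (P.restrict T) Xi C ∧ SamePCCompPag (P.restrict T) Xi C

/-- `B 1 < ... < B m` is a partial topological order over the buckets of `G` covering `T`. -/
def IsBucketTopEnum {V : Type} (G : MixedGraph V) (T : Set V)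
    {m : ℕ} (B : Fin m → Set V) : Prop :=
  (∀ i, (B i).Nonempty) ∧ (∀ i, B i ⊆ T) ∧ (⋃ i, B i) = T ∧
  (∀ i j, i ≠ j → Disjoint (B i) (B j)) ∧
  (∀ i, ∀ a ∈ B i, B i = {b | G.SameBucket a b}) ∧
  (∀ i j, i ≠ j → ∀ a ∈ B i, ∀ b ∈ B j, G.mark a b = some Mark.arrow → i < j)

/-- `B` is a bucket of `G` (with representative in `T`). -/
def IsBucketOf {V : Type} (G : MixedGraph V) (T B : Set V) : Prop :=
  ∃ a ∈ T, B = {b | G.SameBucket a b}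

/-! ### Discrete causal models and c-factors -/

/-- A discrete causal model of a DAG `D`, with observed variables valued in `Ω`. -/
structure CModel {V L : Type} [DecidableEq V] [DecidableEq L]
    (D : LatDAG V L) (Ω : Type) [Fintype Ω] where
  latS : L → Type
  latFin : ∀ l : L, Fintype (latS l)
  latNE : ∀ l : L, Nonempty (latS l)
  cpt : V ⊕ L → (V → Ω) × (∀ l : L, latS l) → ℝ
  cpt_nonneg : ∀ x c, 0 ≤ cpt x c
  cpt_local : ∀ (x : V ⊕ L) (c c' : (V → Ω) × (∀ l : L, latS l)),
    (∀ v : V, (x = Sum.inl v ∨ D.edge (Sum.inl v) x) → c.1 v = c'.1 v) →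
    (∀ l : L, (x = Sum.inr l ∨ D.edge (Sum.inr l) x) → c.2 l = c'.2 l) →
    cpt x c = cpt x c'
  cpt_norm_obs : ∀ (v : V) (c : (V → Ω) × (∀ l : L, latS l)),
    ∑ ω : Ω, cpt (Sum.inl v) (Function.update c.1 v ω, c.2) = 1
  cpt_norm_lat : ∀ (l : L) (c : (V → Ω) × (∀ l : L, latS l)),
    ((@Finset.univ (latS l) (latFin l)).sum
      fun s => cpt (Sum.inr l) (c.1, Function.update c.2 l s)) = 1

/-- The c-factor `Q[T]`, as a function of a full assignment to the observed variables
(the values outside `T` play the role of the intervention values). -/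
noncomputable def CModel.Q {V L : Type} [Fintype V] [DecidableEq V] [Fintype L]
    [DecidableEq L] {D : LatDAG V L} {Ω : Type} [Fintype Ω]
    (M : CModel D Ω) (T : Set V) (c : V → Ω) : ℝ :=
  letI : ∀ l : L, Fintype (M.latS l) := M.latFin
  ∑ g : ∀ l : L, M.latS l,
    (∏ v : V, if v ∈ T then M.cpt (Sum.inl v) (c, g) else 1) *
      ∏ l : L, M.cpt (Sum.inr l) (c, g)

/-- `Q[T \ X]` is identifiable from `Q[T]` in the PAG `P`: a single functional maps
`Q[T]` to `Q[T \ X]` uniformly over every DAG in the class represented by `P`. -/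
def QIdentifiable {V : Type} [Fintype V] [DecidableEq V]
    (P : MixedGraph V) (T X : Set V) : Prop :=
  ∀ (Ω : Type) [Fintype Ω] [Nonempty Ω],
    ∃ F : ((V → Ω) → ℝ) → ((V → Ω) → ℝ),
      ∀ (L : Type) [Fintype L] [DecidableEq L] (D : LatDAG V L),
        D.IsCausalDAG → DagInClass P D →
        ∀ M : CModel D Ω, F (M.Q T) = M.Q (T \ X)

/-- `Q[T \ X]` is identifiable from `Q[T]` in the DAG `D`. -/
def DagIdentifiable {V L : Type} [Fintype V] [DecidableEq V] [Fintype L] [DecidableEq L]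
    (D : LatDAG V L) (T X : Set V) : Prop :=
  ∀ (Ω : Type) [Fintype Ω] [Nonempty Ω],
    ∃ F : ((V → Ω) → ℝ) → ((V → Ω) → ℝ),
      ∀ M : CModel D Ω, F (M.Q T) = M.Q (T \ X)

/-- Probability, under the distribution `q` over the variables of `T` (context fixed
outside `T`), that the variables of `W` take the values given by `c`. -/
noncomputable def MarginProb {V Ω : Type} [Fintype V] [Fintype Ω]
    (T : Set V) (q : (V → Ω) → ℝ) (W : Set V) (c : V → Ω) : ℝ :=
  ∑ d : V → Ω, if (∀ v : V, (v ∈ W ∨ v ∉ T) → d v = c v) then q d else 0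

/-- Conditional term `P_{v\t}(Bi | Prev)` computed from `q = Q[T]`. -/
noncomputable def CondTerm {V Ω : Type} [Fintype V] [Fintype Ω]
    (T : Set V) (q : (V → Ω) → ℝ) (Bi Prev : Set V) (c : V → Ω) : ℝ :=
  MarginProb T q (Bi ∪ Prev) c / MarginProb T q Prev c

/-- Product of the conditional terms of the buckets contained in the dc-component of `X`. -/
noncomputable def BucketDenom {V Ω : Type} [Fintype V] [Fintype Ω]
    (P : MixedGraph V) (T X : Set V) {m : ℕ} (B : Fin m → Set V)
    (q : (V → Ω) → ℝ) (c : V → Ω) : ℝ :=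
  ∏ i ∈ Finset.univ.filter (fun i : Fin m => B i ⊆ DCComp (P.restrict T) X),
    CondTerm T q (B i) {v | ∃ j : Fin m, j < i ∧ v ∈ B j} c

/-- The identification formula: `Q[T\X] = (Q[T] / ∏ P(B_i | B^{(i-1)})) · Σ_x ∏ P(B_i |
B^{(i-1)})`, the product over the buckets of `P_T` inside the dc-component of `X` in a
partial topological order, summed over the values of `X` in the numerator. -/
def BucketFormula {V : Type} [Fintype V] [DecidableEq V]
    (P : MixedGraph V) (T X : Set V) : Prop :=
  ∀ (m : ℕ) (B : Fin m → Set V), IsBucketTopEnum (P.restrict T) T B →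
    ∀ (Ω : Type) [Fintype Ω] [Nonempty Ω] (L : Type) [Fintype L] [DecidableEq L]
      (D : LatDAG V L), D.IsCausalDAG → DagInClass P D →
      ∀ (M : CModel D Ω) (c : V → Ω),
        M.Q (T \ X) c =
          M.Q T c / BucketDenom P T X B (M.Q T) c *
            ∑ d : V → Ω,
              if (∀ v : V, v ∉ X → d v = c v) then BucketDenom P T X B (M.Q T) d else 0

/-- A hedge for `Q[W]` (`W = T \ X`) formed by the intervention set `X`. -/
def IsHedge {V L : Type} (D : LatDAG V L) (W X : Set V) (F F' : Set V) : Prop :=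
  ∃ R : Set V, R ⊆ W ∧ F' ⊆ F ∧ F ⊆ W ∪ X ∧ (F ∩ X).Nonempty ∧ F' ∩ X = ∅ ∧
    D.CForest F R ∧ D.CForest F' R

/-! ### Adjustment, GAC and the IDP algorithm -/

/-- Proper possibly directed path from the set `X` to the set `Y` in a PAG. -/
def ProperPDPath {V : Type} (P : MixedGraph V) (X Y : Set V) (p : List V) : Prop :=
  P.IsPath p ∧ (∃ x ∈ X, p.head? = some x) ∧ (∃ y ∈ Y, p.getLast? = some y) ∧
  (∀ v ∈ p.tail, v ∉ X) ∧ ∀ a b : V, ListEdge p a b → P.mark b a ≠ some Mark.arrow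

/-- `P` is amenable relative to `(X, Y)`: every proper possibly directed path from `X`
to `Y` starts with a visible directed edge out of `X`. -/
def Amenable {V : Type} (P : MixedGraph V) (X Y : Set V) : Prop :=
  ∀ p : List V, ProperPDPath P X Y p →
    ∃ a b : V, p[0]? = some a ∧ p[1]? = some b ∧ PagVisible P a b

/-- The forbidden set: possible descendants of nodes `w ∉ X` lying on proper possibly
directed paths from `X` to `Y`. -/
def Forb {V : Type} (P : MixedGraph V) (X Y : Set V) : Set V :=
  {d | ∃ (w : V) (p : List V), ProperPDPath P X Y p ∧ w ∈ p ∧ w ∉ X ∧ P.PossAnc w d}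

/-- Proper definite status non-causal path from `X` to `Y`. -/
def ProperDefNonCausal {V : Type} (P : MixedGraph V) (X Y : Set V) (p : List V) : Prop :=
  P.IsPath p ∧ P.DefStatusPath p ∧ (∃ x ∈ X, p.head? = some x) ∧
  (∃ y ∈ Y, p.getLast? = some y) ∧ (∀ v ∈ p.tail, v ∉ X) ∧
  ∃ a b : V, ListEdge p a b ∧ P.mark b a = some Mark.arrow

/-- `Z` blocks the definite status path `p`. -/
def BlocksPath {V : Type} (P : MixedGraph V) (Z : Set V) (p : List V) : Prop :=
  (∃ a b c : V, ListTriple p a b c ∧ P.DefNonCollider a b c ∧ b ∈ Z) ∨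
  (∃ a b c : V, ListTriple p a b c ∧ P.Collider a b c ∧ ∀ z ∈ Z, ¬ P.PossAnc b z)

/-- `Z` satisfies the generalized adjustment criterion relative to `(X, Y)` in `P`. -/
def SatGAC {V : Type} (P : MixedGraph V) (X Y Z : Set V) : Prop :=
  Amenable P X Y ∧ Z ∩ Forb P X Y = ∅ ∧
  ∀ p : List V, ProperDefNonCausal P X Y p → BlocksPath P Z p

/-- The canonical adjustment set `Adjust(X, Y, P)`. -/
def AdjustSet {V : Type} (P : MixedGraph V) (X Y : Set V) : Set V :=
  {v | ∃ w ∈ X ∪ Y, P.PossAnc v w} \ (Forb P X Y ∪ X ∪ Y)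

/-- The subroutine `Identify(C, T, Q[T])` of IDP succeeds: it repeatedly removes a
bucket of `P_T` disjoint from `C` satisfying the interventional criterion, until `T = C`. -/
inductive IdentifySucc {V : Type} (P : MixedGraph V) (C : Set V) : Set V → Prop
  | base : IdentifySucc P C C
  | step (T B : Set V) (hBT : B ⊆ T) (hBC : Disjoint B C) (hne : B.Nonempty)
      (hbucket : IsBucketOf (P.restrict T) T B) (hcrit : BucketCrit P T B)
      (h : IdentifySucc P C (T \ B)) : IdentifySucc P C T

/-- The IDP algorithm succeeds on `P_x(y)`: with `D` the set of possible ancestors of `Y`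
in `P_{V \ X}`, every cpc-component of `P_D` is identified by `Identify` from `Q[V]`. -/
def IDPSucc {V : Type} (P : MixedGraph V) (X Y : Set V) : Prop :=
  ∀ a ∈ {d : V | ∃ y ∈ Y, (P.restrict Xᶜ).PossAnc d y},
    IdentifySucc P
      {b : V | b ∈ {d : V | ∃ y ∈ Y, (P.restrict Xᶜ).PossAnc d y} ∧
        Relation.ReflTransGen
          (fun u w =>
            SamePCCompPag (P.restrict {d : V | ∃ y ∈ Y, (P.restrict Xᶜ).PossAnc d y}) u w ∨
            (P.restrict {d : V | ∃ y ∈ Y, (P.restrict Xᶜ).PossAnc d y}).SameBucket u w)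
          a b}
      Set.univ

/-- Definite m-connecting path in a PAG given `Z`. -/
def DefMConnPath {V : Type} (P : MixedGraph V) (Z : Set V) (X Y : V) (p : List V) : Prop :=
  P.IsPathBetween X Y p ∧
  ∀ a b c : V, ListTriple p a b c →
    (P.Collider a b c → ∃ z ∈ Z, P.PossAnc b z) ∧
    (¬ P.Collider a b c → P.DefNonCollider a b c ∧ b ∉ Z)

/-! ### Collider paths in the MAG from bi-directed paths in the DAG -/

theorem ListTriple.exists_append {α : Type} {p : List α} {a b c : α} (h : ListTriple p a b c) :
    ∃ l₁ l₂ : List α, p = l₁ ++ a :: b :: c :: l₂ := by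
  obtain ⟨i, ha, hb, hc⟩ := h
  obtain ⟨hi, rfl⟩ := List.getElem?_eq_some_iff.1 ha
  obtain ⟨hi₁, rfl⟩ := List.getElem?_eq_some_iff.1 hb
  obtain ⟨hi₂, rfl⟩ := List.getElem?_eq_some_iff.1 hc
  refine ⟨p.take i, p.drop (i + 3), ?_⟩
  rw [← List.drop_eq_getElem_cons hi₂, ← List.drop_eq_getElem_cons hi₁,
    ← List.drop_eq_getElem_cons hi, List.take_append_drop]

theorem ListEdge.exists_append {α : Type} {p : List α} {a b : α} (h : ListEdge p a b) :
    ∃ l₁ l₂ : List α, p = l₁ ++ a :: b :: l₂ := by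
  obtain ⟨i, ha, hb⟩ := h
  obtain ⟨hi, rfl⟩ := List.getElem?_eq_some_iff.1 ha
  obtain ⟨hi₁, rfl⟩ := List.getElem?_eq_some_iff.1 hb
  refine ⟨p.take i, p.drop (i + 2), ?_⟩
  rw [← List.drop_eq_getElem_cons hi₁, ← List.drop_eq_getElem_cons hi, List.take_append_drop]

/-- In a list without duplicates, two contiguous blocks sharing an endpoint can be glued. -/
theorem isInfix_glue {α : Type} {p s t : List α} {b : α} (hp : p.Nodup)
    (hs : s ++ [b] <:+: p) (ht : b :: t <:+: p) : s ++ b :: t <:+: p := by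
  obtain ⟨u₁, u₂, hu⟩ := hs
  obtain ⟨w₁, w₂, hw⟩ := ht
  have hu' : (u₁ ++ s) ++ b :: u₂ = p := by simp [← hu]
  have hw' : w₁ ++ b :: (t ++ w₂) = p := by simp [← hw]
  have hn : b ∉ u₁ ++ s ∧ b ∉ u₂ := by
    rw [← hu', List.nodup_middle, List.nodup_cons] at hp
    simpa [not_or, and_assoc] using hp.1
  obtain ⟨-, -, h⟩ := (List.append_cons_inj_of_notMem hn.1 hn.2).1 (hu'.trans hw'.symm)
  exact ⟨u₁, w₂, by simp [← hu', h]⟩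

namespace LatDAG

variable {V L : Type} {D : LatDAG V L}

theorem LatentSib.symm {a b : V} (h : D.LatentSib a b) : D.LatentSib b a :=
  ⟨h.1.symm, h.2.imp fun _ hl => hl.symm⟩

theorem BiPath.reverse {p : List V} (h : D.BiPath p) : D.BiPath p.reverse := by
  refine ⟨by simpa using h.1, List.nodup_reverse.2 h.2.1, ?_⟩
  exact List.isChain_reverse.2 (List.IsChain.imp (fun _ _ => LatentSib.symm) h.2.2)

theorem IsCausalDAG.child_mem {D : LatDAG V L} (hD : D.IsCausalDAG) {l : L} {a b c : V}
    (hab : a ≠ b) (ha : D.edge (Sum.inr l) (Sum.inl a)) (hb : D.edge (Sum.inr l) (Sum.inl b))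
    (hc : D.edge (Sum.inr l) (Sum.inl c)) : c = a ∨ c = b := by
  obtain ⟨x, y, -, -, -, h⟩ := hD.2.2 l
  have h₁ := h _ ha
  have h₂ := h _ hb
  have h₃ := h _ hc
  simp only [Sum.inl.injEq] at h₁ h₂ h₃
  grind

/-- Inserting the latent parents between the nodes of a bi-directed path yields a path of the
DAG on which every observed node is entered only by arrowheads. -/
theorem exists_expanded_path (hD : D.IsCausalDAG) (a : V) (s : List V) (hn : (a :: s).Nodup)
    (hs : List.IsChain D.LatentSib (a :: s)) :
    ∃ q : List (V ⊕ L),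
      s.length ≤ q.length ∧
      (Sum.inl a :: q).Nodup ∧
      List.IsChain D.Adj (Sum.inl a :: q) ∧
      (Sum.inl a :: q).getLast? = (a :: s).getLast?.map Sum.inl ∧
      (∀ y, q.head? = some y → D.edge y (Sum.inl a)) ∧
      (∀ v, Sum.inl v ∈ q → v ∈ s) ∧
      (∀ l, Sum.inr l ∈ q → ∃ u ∈ a :: s, ∃ w ∈ a :: s, u ≠ w ∧
        D.edge (Sum.inr l) (Sum.inl u) ∧ D.edge (Sum.inr l) (Sum.inl w)) ∧
      ∀ x y z, ListTriple (Sum.inl a :: q) x y z → ∀ v : V, y = Sum.inl v →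
        D.edge x y ∧ D.edge z y := by
  induction s generalizing a with
  | nil =>
    refine ⟨[], by simp, by simp, by simp, by simp, by simp, by simp, by simp, ?_⟩
    rintro x y z ⟨i, -, h, -⟩
    simp at h
  | cons b s ih =>
    rw [List.isChain_cons_cons] at hs
    obtain ⟨⟨hab, l, hla, hlb⟩, hs⟩ := hs
    rw [List.nodup_cons] at hn
    obtain ⟨q, hlen, hnq, hadj, hlast, hinto, hobs, hlat, htri⟩ := ih b hn.2 hs
    have hla_q : (Sum.inl a : V ⊕ L) ∉ Sum.inl b :: q := by
      intro h
      rcases List.mem_cons.1 h with h | h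
      · exact hab (Sum.inl.inj h)
      · exact hn.1 (List.mem_cons_of_mem _ (hobs _ h))
    have hl_q : (Sum.inr l : V ⊕ L) ∉ Sum.inl b :: q := by
      intro h
      obtain ⟨u, hu, w, hw, huw, hlu, hlw⟩ := hlat l (by simpa using h)
      have h₁ := hD.child_mem hab hla hlb hlu
      have h₂ := hD.child_mem hab hla hlb hlw
      grind
    refine ⟨Sum.inr l :: Sum.inl b :: q, by simp; omega, ?_, ?_, ?_, ?_, ?_, ?_, ?_⟩
    · refine List.nodup_cons.2 ⟨?_, List.nodup_cons.2 ⟨hl_q, hnq⟩⟩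
      simpa using hla_q
    · exact List.isChain_cons_cons.2 ⟨Or.inr hla, List.isChain_cons_cons.2 ⟨Or.inl hlb, hadj⟩⟩
    · simpa [List.getLast?_cons_cons] using hlast
    · simpa using hla
    · intro v hv
      simp only [List.mem_cons, reduceCtorEq, Sum.inl.injEq, false_or] at hv ⊢
      exact hv.imp_right (hobs v)
    · intro l' hl'
      simp only [List.mem_cons, Sum.inr.injEq, reduceCtorEq, false_or] at hl'
      rcases hl' with rfl | hl'
      · exact ⟨a, by simp, b, by simp, hab, hla, hlb⟩
      · obtain ⟨u, hu, w, hw, h⟩ := hlat l' hl'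
        exact ⟨u, List.mem_cons_of_mem _ hu, w, List.mem_cons_of_mem _ hw, h⟩
    · rintro x y z ⟨i, hx, hy, hz⟩ v rfl
      match i with
      | 0 => simp at hy
      | 1 =>
        simp only [List.getElem?_cons_succ, List.getElem?_cons_zero, Option.some.injEq,
          Nat.reduceAdd] at hx hy hz
        subst hx
        rw [← hy]
        exact ⟨hlb, hinto z (by rw [List.head?_eq_getElem?]; exact hz)⟩
      | i + 2 => exact htri x _ z ⟨i, by simpa using hx, by simpa using hy, by simpa using hz⟩ v rfl

/-- A bi-directed path all of whose nodes are ancestors of one of its endpoints gives an inducing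
path that is into its first node. -/
theorem BiPath.exists_inducingPath (hD : D.IsCausalDAG) {a b : V} {s : List V} (hs : D.BiPath s)
    (ha : s.head? = some a) (hb : s.getLast? = some b)
    (hanc : ∀ v ∈ s, D.Anc (Sum.inl v) (Sum.inl a) ∨ D.Anc (Sum.inl v) (Sum.inl b)) :
    ∃ r : List (V ⊕ L), D.InducingPath a b r ∧ D.IntoFirst r := by
  obtain ⟨t, rfl⟩ := List.head?_eq_some_iff.1 ha
  obtain ⟨hlen, hn, hc⟩ := hs
  obtain ⟨q, hq, hnq, hadj, hlast, hinto, hobs, -, htri⟩ := exists_expanded_path hD a t hn hc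
  simp only [List.length_cons] at hlen
  refine ⟨Sum.inl a :: q, ⟨⟨⟨by simp; omega, hnq, hadj⟩, rfl, by simp [hlast, hb]⟩, ?_⟩, ?_⟩
  · rintro x y z h v rfl
    refine ⟨htri x _ z h v rfl, hanc v ?_⟩
    obtain ⟨i, -, hy, -⟩ := h
    have hv := List.mem_of_getElem? hy
    simp only [List.mem_cons, Sum.inl.injEq] at hv ⊢
    exact hv.imp_right (hobs v)
  · cases q with
    | nil => simp only [List.length_nil] at hq; omega
    | cons y q => exact ⟨Sum.inl a, y, rfl, rfl, hinto y rfl⟩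

/-- The block of `p` from `a` to `b` consists of ancestors of `a` or `b`. -/
def InducingBlock (D : LatDAG V L) (p : List V) (a b : V) : Prop :=
  ∃ t : List V, a :: (t ++ [b]) <:+: p ∧
    ∀ v ∈ t, D.Anc (Sum.inl v) (Sum.inl a) ∨ D.Anc (Sum.inl v) (Sum.inl b)

theorem InducingBlock.trans {p : List V} {a b c : V} (hp : p.Nodup)
    (hab : D.InducingBlock p a b) (hbc : D.InducingBlock p b c)
    (hb : D.Anc (Sum.inl b) (Sum.inl a) ∨ D.Anc (Sum.inl b) (Sum.inl c)) :
    D.InducingBlock p a c := by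
  obtain ⟨s, hs, hsa⟩ := hab
  obtain ⟨t, ht, hta⟩ := hbc
  refine ⟨s ++ b :: t, ?_, ?_⟩
  · simpa using isInfix_glue (s := a :: s) hp (by simpa using hs) ht
  · have key : ∀ v, D.Anc (Sum.inl v) (Sum.inl b) →
        D.Anc (Sum.inl v) (Sum.inl a) ∨ D.Anc (Sum.inl v) (Sum.inl c) := fun v hv =>
      hb.imp (Relation.ReflTransGen.trans hv) (Relation.ReflTransGen.trans hv)
    intro v hv
    rcases List.mem_append.1 hv with hv | hv
    · exact (hsa v hv).elim Or.inl (key v)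
    · rcases List.mem_cons.1 hv with rfl | hv
      · exact hb
      · exact (hta v hv).elim (key v) Or.inr

theorem InducingBlock.exists_inducingPath (hD : D.IsCausalDAG) {p : List V} (hp : D.BiPath p)
    {a b : V} (h : D.InducingBlock p a b) :
    (∃ r : List (V ⊕ L), D.InducingPath a b r ∧ D.IntoFirst r) ∧
      ∃ r : List (V ⊕ L), D.InducingPath b a r ∧ D.IntoFirst r := by
  obtain ⟨t, ht, hanc⟩ := h
  have hs : D.BiPath (a :: (t ++ [b])) :=
    ⟨by simp, hp.2.1.sublist ht.sublist, List.IsChain.infix hp.2.2 ht⟩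
  have hanc' : ∀ v ∈ a :: (t ++ [b]),
      D.Anc (Sum.inl v) (Sum.inl a) ∨ D.Anc (Sum.inl v) (Sum.inl b) := by
    intro v hv
    simp only [List.mem_cons, List.mem_append, List.not_mem_nil, or_false] at hv
    rcases hv with rfl | hv | rfl
    · exact Or.inl .refl
    · exact hanc v hv
    · exact Or.inr .refl
  refine ⟨hs.exists_inducingPath hD rfl (List.getLast?_concat (l := a :: t)) hanc', ?_⟩
  exact hs.reverse.exists_inducingPath hD (by simp) (by rw [List.getLast?_reverse]; rfl)
    fun v hv => (hanc' v (List.mem_reverse.1 hv)).symm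

/-- Deleting nodes that are ancestors of a neighbour, a sequence linked by inducing blocks can be
reduced to one on which no interior node is an ancestor of a neighbour. -/
theorem exists_reduced_sublist {p : List V} (hp : p.Nodup) (p' : List V)
    (hlen : 2 ≤ p'.length) (hc : List.IsChain (D.InducingBlock p) p') :
    ∃ q : List V, q.Sublist p' ∧ 2 ≤ q.length ∧ q.head? = p'.head? ∧ q.getLast? = p'.getLast? ∧
      List.IsChain (D.InducingBlock p) q ∧ ∀ a b c, ListTriple q a b c →
        ¬ D.Anc (Sum.inl b) (Sum.inl a) ∧ ¬ D.Anc (Sum.inl b) (Sum.inl c) := by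
  by_cases h : ∀ a b c, ListTriple p' a b c →
      ¬ D.Anc (Sum.inl b) (Sum.inl a) ∧ ¬ D.Anc (Sum.inl b) (Sum.inl c)
  · exact ⟨p', List.Sublist.refl _, hlen, rfl, rfl, hc, h⟩
  · simp only [not_forall, not_and_or, not_not] at h
    obtain ⟨a, b, c, habc, hb⟩ := h
    obtain ⟨l₁, l₂, rfl⟩ := habc.exists_append
    have hc' : List.IsChain (D.InducingBlock p) (l₁ ++ a :: c :: l₂) := by
      rw [List.isChain_append_cons_cons, List.isChain_cons_cons] at hc
      exact List.isChain_append_cons_cons.2 ⟨hc.1, hc.2.1.trans hp hc.2.2.1 hb, hc.2.2.2⟩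
    obtain ⟨q, hq, hq2, hqh, hql, hqc⟩ :=
      exists_reduced_sublist hp (l₁ ++ a :: c :: l₂) (by simp; omega) hc'
    refine ⟨q, hq.trans ?_, hq2, hqh.trans ?_, hql.trans ?_, hqc⟩
    · exact (List.Sublist.refl _).append ((List.sublist_cons_self _ _).cons_cons a)
    · simp
    · simp [List.getLast?_append, List.getLast?_cons_cons]
termination_by p'.length

end LatDAG

theorem IsMAGof.mark_eq_arrow {V L : Type} {M : MixedGraph V} {D : LatDAG V L}
    (hMD : IsMAGof M D) {a b : V} (hab : M.Adj a b) (h : ¬ D.Anc (Sum.inl b) (Sum.inl a)) :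
    M.mark a b = some Mark.arrow := by
  by_cases hanc : D.Anc (Sum.inl a) (Sum.inl b)
  · exact ((hMD.2 a b hab).1.2 hanc).1
  · exact ((hMD.2 a b hab).2.2 ⟨hanc, h⟩).1

/-- **strengthened Lemma dagmag.** A bi-directed path `p` between `X` and
`Y` in the DAG `G` yields a path `p'` in the MAG `M` over a subsequence of the observed
nodes of `p` on which every non-endpoint node is a collider, and every directed edge
`A → B` on `p'` has an inducing path between `A` and `B` into `A` in `G`. -/
theorem dag_to_mag_collider_path_inducing {V L : Type} (G : LatDAG V L)
    (hG : G.IsCausalDAG)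
    (M : MixedGraph V) (hM : M.IsMAG) (hMG : IsMAGof M G)
    (X Y : V) (p : List V) (hp : G.BiPath p)
    (hhead : p.head? = some X) (hlast : p.getLast? = some Y) :
    ∃ p' : List V, p'.Sublist p ∧ M.IsPathBetween X Y p' ∧ M.AllColliders p' ∧
      ∀ a b : V, ListEdge p' a b →
        (M.DirEdge a b → ∃ r : List (V ⊕ L), G.InducingPath a b r ∧ G.IntoFirst r) ∧
        (M.DirEdge b a → ∃ r : List (V ⊕ L), G.InducingPath b a r ∧ G.IntoFirst r) := by
  have hpc : List.IsChain (G.InducingBlock p) p := by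
    refine List.isChain_iff_forall_rel_of_append_cons_cons.2 fun a b l₁ l₂ h => ?_
    exact ⟨[], ⟨l₁, l₂, by simp [h]⟩, by simp⟩
  obtain ⟨q, hqp, hlen, hqh, hql, hqc, htri⟩ := LatDAG.exists_reduced_sublist hp.2.1 p hp.1 hpc
  have hadj : List.IsChain M.Adj q := hqc.imp fun a b h =>
    (hMG.1 a b).2 ((h.exists_inducingPath hG hp).1.imp fun _ hr => hr.1)
  refine ⟨q, hqp, ⟨⟨hlen, hp.2.1.sublist hqp, hadj⟩, hqh.trans hhead, hql.trans hlast⟩, ?_, ?_⟩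
  · intro a b c habc
    obtain ⟨hba, hbc⟩ := htri a b c habc
    obtain ⟨l₁, l₂, rfl⟩ := habc.exists_append
    rw [List.isChain_append_cons_cons, List.isChain_cons_cons] at hadj
    exact ⟨hMG.mark_eq_arrow hadj.2.1 hba,
      hMG.mark_eq_arrow ((hM.1.1 b c).1 hadj.2.2.1) hbc⟩
  · intro a b hab
    obtain ⟨l₁, l₂, rfl⟩ := hab.exists_append
    have h := (List.isChain_append_cons_cons.1 hqc).2.1.exists_inducingPath hG hp
    exact ⟨fun _ => h.1, fun _ => h.2⟩

end CG
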